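/- Let p ∈ (0,1) with p ≠ 1/2, q = 1 − p, h = −p log p − q log q, and λ = p q (log(p/q))²/h³ > 0. Let (S_n, K_n)_{n≥0} be a random trie pair family with parameter p. Then Var(K_n)/(n log n) → λ as n → ∞. -/

import Mathlib

open MeasureTheory ProbabilityTheory Filter Topology

noncomputable def binomialMeasure (n : ℕ) (p : ℝ) : Measure ℕ :=
  ∑ k ∈ Finset.range (n + 1),
    (ENNReal.ofReal ((n.choose k : ℝ) * p ^ k * (1 - p) ^ (n - k))) • Measure.dirac k

/-- The combination map `(B, (S',K')_j, (S'',K'')_j) ↦ (S'_B + S''_{n-B} + 1, K'_B + K''_{n-B} + n)`. -/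
def trieStep (n : ℕ) (ω : ℕ × ((ℕ → ℕ × ℕ) × (ℕ → ℕ × ℕ))) : ℕ × ℕ :=
  ((ω.2.1 ω.1).1 + (ω.2.2 (n - ω.1)).1 + 1,
   (ω.2.1 ω.1).2 + (ω.2.2 (n - ω.1)).2 + n)

/-- A random trie pair family with parameter `p`, given by the joint laws
`μ n` of `(S_n, K_n)` on `ℕ × ℕ`. -/
structure IsTriePairFamily (p : ℝ) (μ : ℕ → Measure (ℕ × ℕ)) : Prop where
  prob : ∀ n, IsProbabilityMeasure (μ n)
  moments : ∀ n r : ℕ, Integrable (fun x : ℕ × ℕ => ((x.1 : ℝ) + (x.2 : ℝ)) ^ r) (μ n)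
  init0 : μ 0 = Measure.dirac (0, 0)
  init1 : μ 1 = Measure.dirac (0, 0)
  recur : ∀ n, 2 ≤ n → ∃ P : Measure (ℕ × ((ℕ → ℕ × ℕ) × (ℕ → ℕ × ℕ))),
    IsProbabilityMeasure P ∧
    P.map Prod.fst = binomialMeasure n p ∧
    (∀ j, P.map (fun ω => ω.2.1 j) = μ j) ∧
    (∀ j, P.map (fun ω => ω.2.2 j) = μ j) ∧
    P = (P.map Prod.fst).prod
          ((P.map (fun ω => ω.2.1)).prod (P.map (fun ω => ω.2.2))) ∧
    μ n = P.map (trieStep n)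

noncomputable def eS (μ : ℕ → Measure (ℕ × ℕ)) (n : ℕ) : ℝ := ∫ x, (x.1 : ℝ) ∂ μ n

noncomputable def eK (μ : ℕ → Measure (ℕ × ℕ)) (n : ℕ) : ℝ := ∫ x, (x.2 : ℝ) ∂ μ n

noncomputable def varS (μ : ℕ → Measure (ℕ × ℕ)) (n : ℕ) : ℝ :=
  ∫ x, ((x.1 : ℝ) - eS μ n) ^ 2 ∂ μ n

noncomputable def varK (μ : ℕ → Measure (ℕ × ℕ)) (n : ℕ) : ℝ :=
  ∫ x, ((x.2 : ℝ) - eK μ n) ^ 2 ∂ μ n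

noncomputable def covSK (μ : ℕ → Measure (ℕ × ℕ)) (n : ℕ) : ℝ :=
  ∫ x, ((x.1 : ℝ) - eS μ n) * ((x.2 : ℝ) - eK μ n) ∂ μ n

/-- The expectation of `f B` when `B` has the binomial distribution with parameters `n`, `p`
(and `q = 1 - p`). -/
noncomputable def binExp (p q : ℝ) (n : ℕ) (f : ℕ → ℝ) : ℝ :=
  ∑ k ∈ Finset.range (n + 1), (n.choose k : ℝ) * p ^ k * q ^ (n - k) * f k

/-- The variance of `f B` when `B` is binomial. -/
noncomputable def binVar (p q : ℝ) (n : ℕ) (f : ℕ → ℝ) : ℝ :=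
  binExp p q n (fun k => (f k - binExp p q n f) ^ 2)

/-- The expectation of `x B + x (n - B)` when `B` is binomial. -/
noncomputable def splitExp (p q : ℝ) (x : ℕ → ℝ) (n : ℕ) : ℝ :=
  binExp p q n (fun k => x k + x (n - k))

section BinExp

variable {p q : ℝ}

lemma binExp_congr {n : ℕ} {f g : ℕ → ℝ} (H : ∀ k ≤ n, f k = g k) :
    binExp p q n f = binExp p q n g :=
  Finset.sum_congr rfl fun k hk => by rw [H k (Finset.mem_range_succ_iff.mp hk)]

lemma binExp_mono (hp : 0 ≤ p) (hq : 0 ≤ q) {n : ℕ} {f g : ℕ → ℝ} (H : ∀ k ≤ n, f k ≤ g k) :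
    binExp p q n f ≤ binExp p q n g :=
  Finset.sum_le_sum fun k hk =>
    mul_le_mul_of_nonneg_left (H k (Finset.mem_range_succ_iff.mp hk)) (by positivity)

lemma binExp_add (n : ℕ) (f g : ℕ → ℝ) :
    binExp p q n (fun k => f k + g k) = binExp p q n f + binExp p q n g := by
  simp only [binExp, mul_add, Finset.sum_add_distrib]

lemma binExp_sub (n : ℕ) (f g : ℕ → ℝ) :
    binExp p q n (fun k => f k - g k) = binExp p q n f - binExp p q n g := by
  simp only [binExp, mul_sub, Finset.sum_sub_distrib]

lemma binExp_mul (n : ℕ) (c : ℝ) (f : ℕ → ℝ) :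
    binExp p q n (fun k => c * f k) = c * binExp p q n f := by
  simp only [binExp, Finset.mul_sum]
  exact Finset.sum_congr rfl fun k _ => by ring

lemma binExp_const (hpq : p + q = 1) (n : ℕ) (c : ℝ) : binExp p q n (fun _ => c) = c := by
  have := add_pow p q n
  rw [hpq, one_pow] at this
  rw [binExp, ← Finset.sum_mul]
  have h2 : ∑ k ∈ Finset.range (n + 1), (n.choose k : ℝ) * p ^ k * q ^ (n - k) = 1 := by
    rw [this]
    exact Finset.sum_congr rfl fun k _ => by ring
  rw [h2, one_mul]

lemma binExp_reflect (n : ℕ) (f : ℕ → ℝ) :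
    binExp p q n (fun k => f (n - k)) = binExp q p n f := by
  unfold binExp
  rw [← Finset.sum_range_reflect]
  refine Finset.sum_congr rfl fun k hk => ?_
  have hk' : k ≤ n := Finset.mem_range_succ_iff.mp hk
  have h1 : n + 1 - 1 - k = n - k := by omega
  simp only [h1, Nat.choose_symm hk', Nat.sub_sub_self hk']
  ring

lemma binExp_succ (n : ℕ) (f : ℕ → ℝ) :
    binExp p q (n + 1) f = binExp p q n (fun k => p * f (k + 1) + q * f k) := by
  have h1 : ∑ k ∈ Finset.range (n + 1), (n.choose (k + 1) : ℝ) * p ^ (k + 1) * q ^ (n - k) * f (k + 1)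
      + q ^ (n + 1) * f 0
      = ∑ k ∈ Finset.range (n + 1), (n.choose k : ℝ) * p ^ k * q ^ (n + 1 - k) * f k := by
    have := Finset.sum_range_succ'
      (fun k => (n.choose k : ℝ) * p ^ k * q ^ (n + 1 - k) * f k) (n + 1)
    simp only [Nat.add_sub_add_right, Nat.choose_zero_right, Nat.cast_one, pow_zero, mul_one,
      one_mul, Nat.sub_zero] at this
    rw [← this, Finset.sum_range_succ, Nat.choose_succ_self]
    simp
  unfold binExp
  rw [Finset.sum_range_succ']
  simp only [Nat.add_sub_add_right, Nat.choose_zero_right, Nat.cast_one, pow_zero, mul_one,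
      one_mul, Nat.sub_zero, Nat.choose_succ_succ', Nat.cast_add, add_mul, mul_add,
      Finset.sum_add_distrib]
  rw [add_assoc, h1]
  congr 1
  · exact Finset.sum_congr rfl fun k _ => by ring
  · refine Finset.sum_congr rfl fun k hk => ?_
    rw [Nat.succ_sub (Finset.mem_range_succ_iff.mp hk), pow_succ]
    ring

/-- Size biasing of the binomial distribution. -/
lemma binExp_succ_mul (n : ℕ) (f : ℕ → ℝ) :
    binExp p q (n + 1) (fun k => (k : ℝ) * f (k - 1)) = (n + 1) * (p * binExp p q n f) := by
  unfold binExp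
  rw [Finset.sum_range_succ']
  simp only [Nat.cast_zero, zero_mul, mul_zero, add_zero, Nat.add_sub_cancel,
    Nat.add_sub_add_right, Finset.mul_sum]
  refine Finset.sum_congr rfl fun k _ => ?_
  have h1 : ((n : ℝ) + 1) * n.choose k = (n + 1).choose (k + 1) * (k + 1) := by
    exact_mod_cast Nat.add_one_mul_choose_eq n k
  calc _ = ((n + 1).choose (k + 1) * ((k : ℝ) + 1)) * p ^ (k + 1) * q ^ (n - k) * f k := by
        push_cast; ring
    _ = _ := by rw [← h1]; ring

lemma splitExp_eq (n : ℕ) (x : ℕ → ℝ) :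
    splitExp p q x n = binExp p q n x + binExp q p n x := by
  rw [splitExp, binExp_add, binExp_reflect]

lemma splitExp_succ_mul (n : ℕ) (f : ℕ → ℝ) :
    splitExp p q (fun k => (k : ℝ) * f (k - 1)) (n + 1)
      = (n + 1) * binExp p q n (fun k => p * f k + q * f (n - k)) := by
  rw [splitExp_eq, binExp_succ_mul, binExp_succ_mul, binExp_add, binExp_mul, binExp_mul,
    binExp_reflect]
  ring

lemma splitExp_linear (n : ℕ) (x y : ℕ → ℝ) (c d : ℝ) :
    splitExp p q (fun k => c * x k + d * y k) n = c * splitExp p q x n + d * splitExp p q y n := by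
  simp only [splitExp_eq, binExp_add, binExp_mul]
  ring

lemma binExp_id (hpq : p + q = 1) (n : ℕ) : binExp p q n (fun k => (k : ℝ)) = n * p := by
  cases n with
  | zero => simp [binExp]
  | succ n =>
    have := binExp_succ_mul (p := p) (q := q) n (fun _ => 1)
    simp only [mul_one] at this
    rw [this, binExp_const hpq]
    push_cast; ring

lemma sq_binExp_le (hp : 0 ≤ p) (hq : 0 ≤ q) (hpq : p + q = 1) (n : ℕ) (f : ℕ → ℝ) :
    binExp p q n f ^ 2 ≤ binExp p q n (fun k => f k ^ 2) := by
  set m := binExp p q n f with hm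
  have h1 : binExp p q n (fun k => 2 * m * f k - m ^ 2) ≤ binExp p q n (fun k => f k ^ 2) :=
    binExp_mono hp hq fun k _ => by nlinarith [sq_nonneg (f k - m)]
  rw [binExp_sub, binExp_mul, binExp_const hpq, ← hm] at h1
  linarith

lemma binVar_eq (hpq : p + q = 1) (n : ℕ) (f : ℕ → ℝ) :
    binVar p q n f = binExp p q n (fun k => f k ^ 2) - binExp p q n f ^ 2 := by
  set m := binExp p q n f with hm
  have h1 : binVar p q n f = binExp p q n (fun k => f k ^ 2 - (2 * m * f k - m ^ 2)) :=
    binExp_congr fun k _ => by rw [← hm]; ring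
  rw [h1, binExp_sub, binExp_sub, binExp_mul, binExp_const hpq, ← hm]
  ring

/-- The one-step decomposition of the variance of a function of a binomial variable. -/
lemma binVar_succ (hpq : p + q = 1) (n : ℕ) (f : ℕ → ℝ) :
    binVar p q (n + 1) f = p * q * binExp p q n (fun k => (f (k + 1) - f k) ^ 2)
      + binVar p q n (fun k => p * f (k + 1) + q * f k) := by
  have hq : q = 1 - p := by linarith
  rw [binVar_eq hpq, binVar_eq hpq, binExp_succ, binExp_succ, ← binExp_mul, ← add_sub_assoc,
    ← binExp_add]
  congr 1
  exact binExp_congr fun k _ => by rw [hq]; ring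

/-- The Efron-Stein inequality for functions of a binomial variable. -/
lemma binVar_succ_le (hp : 0 ≤ p) (hq : 0 ≤ q) (hpq : p + q = 1) (n : ℕ) (f : ℕ → ℝ) :
    binVar p q (n + 1) f ≤ (n + 1) * (p * q * binExp p q n (fun k => (f (k + 1) - f k) ^ 2)) := by
  induction n generalizing f with
  | zero =>
    rw [binVar_succ hpq]
    simp [binVar, binExp]
  | succ n ih =>
    rw [binVar_succ hpq]
    have h1 := ih (fun k => p * f (k + 1) + q * f k)
    have h2 : binExp p q n
        (fun k => (p * f (k + 1 + 1) + q * f (k + 1) - (p * f (k + 1) + q * f k)) ^ 2)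
        ≤ binExp p q (n + 1) (fun k => (f (k + 1) - f k) ^ 2) := by
      rw [binExp_succ]
      refine binExp_mono hp hq fun k _ => ?_
      have hq' : q = 1 - p := by linarith
      have h3 : 0 ≤ p * q * ((f (k + 1 + 1) - f (k + 1)) - (f (k + 1) - f k)) ^ 2 := by positivity
      rw [hq'] at h3 ⊢
      nlinarith
    have h3 : ((n : ℝ) + 1) * (p * q * binExp p q n
        (fun k => (p * f (k + 1 + 1) + q * f (k + 1) - (p * f (k + 1) + q * f k)) ^ 2))
        ≤ (n + 1) * (p * q * binExp p q (n + 1) (fun k => (f (k + 1) - f k) ^ 2)) := by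
      gcongr
    push_cast
    linarith

lemma binVar_affine (hpq : p + q = 1) (n : ℕ) (c d : ℝ) :
    binVar p q n (fun k => c * k + d) = p * q * c ^ 2 * n := by
  have hq : q = 1 - p := by linarith
  induction n generalizing d with
  | zero => simp [binVar, binExp]
  | succ n ih =>
    rw [binVar_succ hpq]
    have h1 : (fun k : ℕ => p * (c * ((k + 1 : ℕ) : ℝ) + d) + q * (c * k + d))
        = fun k : ℕ => c * (k : ℝ) + (p * c + d) := by
      funext k; rw [hq]; push_cast; ring
    have h2 : (fun k : ℕ => (c * ((k + 1 : ℕ) : ℝ) + d - (c * k + d)) ^ 2) = fun _ => c ^ 2 := by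
      funext k; push_cast; ring
    rw [h1, h2, ih, binExp_const hpq]
    push_cast; ring

lemma binVar_add_le (hp : 0 ≤ p) (hq : 0 ≤ q) (n : ℕ) (f g : ℕ → ℝ) {θ : ℝ}
    (hθ : 0 < θ) :
    binVar p q n (fun k => f k + g k)
      ≤ (1 + θ) * binVar p q n f + (1 + θ⁻¹) * binVar p q n g := by
  unfold binVar
  rw [← binExp_mul, ← binExp_mul, ← binExp_add, binExp_add]
  refine binExp_mono hp hq fun k _ => ?_
  set x := f k - binExp p q n f
  set y := g k - binExp p q n g
  have h1 : f k + g k - (binExp p q n f + binExp p q n g) = x + y := by ring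
  have h2 : (1 + θ) * x ^ 2 + (1 + θ⁻¹) * y ^ 2 - (x + y) ^ 2 = θ⁻¹ * (θ * x - y) ^ 2 := by
    field_simp; ring
  have h3 : 0 ≤ θ⁻¹ * (θ * x - y) ^ 2 := by positivity
  rw [h1]; linarith

end BinExp

section Comparison

variable {p q : ℝ}

lemma binExp_ite_zero (n : ℕ) (c : ℝ) :
    binExp p q n (fun k => if k = 0 then c else 0) = q ^ n * c := by
  simp [binExp]

lemma binExp_ite_self (n : ℕ) (c : ℝ) :
    binExp p q n (fun k => if k = n then c else 0) = p ^ n * c := by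
  simp [binExp]

lemma pow_add_pow_le_of_add_eq_one (hp : 0 < p) (hq : 0 < q) (hpq : p + q = 1) {n : ℕ} (hn : 2 ≤ n) :
    p ^ n + q ^ n ≤ 1 - 2 * p * q := by
  have h1 : p ^ n ≤ p ^ 2 := pow_le_pow_of_le_one hp.le (by linarith) hn
  have h2 : q ^ n ≤ q ^ 2 := pow_le_pow_of_le_one hq.le (by linarith) hn
  have h3 : q = 1 - p := by linarith
  have h4 : p ^ 2 + q ^ 2 = 1 - 2 * p * q := by rw [h3]; ring
  linarith

/-- The comparison principle for the trie recursion. -/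
lemma le_of_splitExp (hp : 0 < p) (hq : 0 < q) (hpq : p + q = 1) {x y t : ℕ → ℝ}
    (h0 : x 0 ≤ y 0) (h1 : x 1 ≤ y 1) (hx : ∀ n, 2 ≤ n → x n ≤ splitExp p q x n + t n)
    (hy : ∀ n, 2 ≤ n → splitExp p q y n + t n ≤ y n) (n : ℕ) : x n ≤ y n := by
  induction n using Nat.strong_induction_on with
  | _ n ih =>
    rcases Nat.lt_or_ge n 2 with hn | hn
    · interval_cases n
      · exact h0
      · exact h1
    · have key : (p ^ n + q ^ n) * (y n - x n)
          ≤ splitExp p q (fun k => 1 * y k + (-1) * x k) n := by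
        rw [add_mul, ← binExp_ite_zero (p := p) (q := q), ← binExp_ite_self (p := p) (q := q),
          ← binExp_add]
        refine binExp_mono hp.le hq.le fun k hk => ?_
        rcases Nat.eq_zero_or_pos k with rfl | hk0
        · rw [if_neg (by omega), if_pos rfl, Nat.sub_zero]
          linarith
        · rcases hk.eq_or_lt with rfl | hkn
          · rw [if_pos rfl, if_neg (by omega), Nat.sub_self]
            linarith
          · rw [if_neg (by omega), if_neg (by omega)]
            have := ih k hkn
            have := ih (n - k) (by omega)
            linarith
      rw [splitExp_linear] at key
      have hx' := hx n hn
      have hy' := hy n hn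
      have hle := pow_add_pow_le_of_add_eq_one hp hq hpq hn
      have hpos : 0 < p * q := mul_pos hp hq
      by_contra hlt
      nlinarith

lemma splitExp_pred_le (hp : 0 < p) (hq : 0 < q) (hpq : p + q = 1) {n : ℕ} (hn : 2 ≤ n) :
    splitExp p q (fun k => ((k - 1 : ℕ) : ℝ)) n ≤ ((n - 1 : ℕ) : ℝ) - 2 * p * q := by
  have h1 : splitExp p q (fun k => ((k - 1 : ℕ) : ℝ)) n
      = binExp p q n (fun k => ((n - 2 : ℕ) : ℝ)
          + ((if k = 0 then 1 else 0) + (if k = n then 1 else 0))) := by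
    refine binExp_congr fun k hk => ?_
    dsimp only
    rcases Nat.eq_zero_or_pos k with rfl | hk0
    · rw [if_neg (by omega : ¬ (0 = n)), if_pos rfl, Nat.sub_zero]
      have h2 : n - 1 = n - 2 + 1 := by omega
      rw [h2]; simp
    · rcases hk.eq_or_lt with rfl | hkn
      · rw [if_neg (by omega), if_pos rfl, Nat.sub_self]
        have h2 : k - 1 = k - 2 + 1 := by omega
        rw [h2]; simp
      · rw [if_neg (by omega), if_neg (by omega)]
        have h2 : k - 1 + (n - k - 1) = n - 2 := by omega
        rw [← h2]; push_cast; ring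
  rw [h1, binExp_add, binExp_add, binExp_const hpq, binExp_ite_zero, binExp_ite_self]
  have h2 : n - 1 = n - 2 + 1 := by omega
  have h3 := pow_add_pow_le_of_add_eq_one hp hq hpq hn
  rw [h2]; push_cast; linarith

end Comparison

section LogMoments

lemma sq_log_le {z : ℝ} (hz : 0 < z) : Real.log z ^ 2 ≤ 4 * (z - 2 + z⁻¹) := by
  obtain ⟨s, hs, rfl⟩ : ∃ s, 0 < s ∧ z = s ^ 2 :=
    ⟨√z, Real.sqrt_pos.mpr hz, (Real.sq_sqrt hz.le).symm⟩
  have h1 : Real.log s ≤ s - 1 := Real.log_le_sub_one_of_pos hs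
  have h2 : 1 - s⁻¹ ≤ Real.log s := Real.one_sub_inv_le_log_of_pos hs
  have h3 : Real.log s ^ 2 ≤ (s - s⁻¹) ^ 2 := by
    rw [sq_le_sq]
    rcases le_total 1 s with hs1 | hs1
    · have h4 : s⁻¹ ≤ 1 := inv_le_one_of_one_le₀ hs1
      rw [abs_of_nonneg (by linarith), abs_of_nonneg (by linarith)]
      linarith
    · have h4 : 1 ≤ s⁻¹ := (one_le_inv₀ hs).mpr hs1
      rw [abs_of_nonpos (by linarith), abs_of_nonpos (by linarith)]
      linarith
  have h4 : (s - s⁻¹) ^ 2 = s ^ 2 - 2 + (s ^ 2)⁻¹ := by field_simp; ring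
  rw [Real.log_pow]
  push_cast
  nlinarith

/-- The logarithm of the normalised shifted binomial value. -/
noncomputable def logRatio (p : ℝ) (n k : ℕ) : ℝ := Real.log (((k : ℝ) + 1) / (p * ((n : ℝ) + 1)))

variable {p q : ℝ}

lemma logRatio_eq (hp : 0 < p) (n k : ℕ) :
    logRatio p n k = Real.log ((k : ℝ) + 1) - (Real.log p + Real.log ((n : ℝ) + 1)) := by
  rw [logRatio, Real.log_div (by positivity) (by positivity),
    Real.log_mul hp.ne' (by positivity)]

lemma binExp_ratio (hp : 0 < p) (hpq : p + q = 1) (n : ℕ) :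
    binExp p q n (fun k => ((k : ℝ) + 1) / (p * ((n : ℝ) + 1))) = 1 + q / (p * ((n : ℝ) + 1)) := by
  have h1 : (fun k : ℕ => ((k : ℝ) + 1) / (p * ((n : ℝ) + 1)))
      = fun k : ℕ => (p * ((n : ℝ) + 1))⁻¹ * ((k : ℝ) + 1) := by
    funext k; field_simp
  rw [h1, binExp_mul, binExp_add, binExp_id hpq, binExp_const hpq]
  have hq : q = 1 - p := by linarith
  rw [hq]
  field_simp
  ring

lemma binExp_inv_ratio_le (hp : 0 < p) (hq : 0 < q) (hpq : p + q = 1) (n : ℕ) :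
    binExp p q n (fun k => (((k : ℝ) + 1) / (p * ((n : ℝ) + 1)))⁻¹) ≤ 1 := by
  have h1 : binExp p q n (fun k => (((k : ℝ) + 1) / (p * ((n : ℝ) + 1)))⁻¹)
      = binExp p q (n + 1) (fun k => (k : ℝ) * (1 / (((k - 1 : ℕ) : ℝ) + 1))) := by
    rw [binExp_succ_mul n (fun k => 1 / ((k : ℝ) + 1)), ← mul_assoc, ← binExp_mul]
    refine binExp_congr fun k _ => ?_
    field_simp
  rw [h1]
  calc _ ≤ binExp p q (n + 1) (fun _ => 1) := by
        refine binExp_mono hp.le hq.le fun k _ => ?_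
        rcases k with _ | k
        · simp
        · simp only [Nat.add_sub_cancel]
          push_cast
          exact (mul_one_div_cancel (by positivity)).le
    _ = 1 := binExp_const hpq _ _

lemma binExp_logRatio_nonneg (hp : 0 < p) (hq : 0 < q) (hpq : p + q = 1) (n : ℕ) :
    0 ≤ binExp p q n (logRatio p n) := by
  have h1 := binExp_inv_ratio_le hp hq hpq n
  have h2 : binExp p q n (fun k => 1 - (((k : ℝ) + 1) / (p * ((n : ℝ) + 1)))⁻¹)
      ≤ binExp p q n (logRatio p n) :=
    binExp_mono hp.le hq.le fun k _ => Real.one_sub_inv_le_log_of_pos (by positivity)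
  rw [binExp_sub, binExp_const hpq] at h2
  linarith

lemma binExp_logRatio_le (hp : 0 < p) (hq : 0 < q) (hpq : p + q = 1) (n : ℕ) :
    binExp p q n (logRatio p n) ≤ q / (p * ((n : ℝ) + 1)) := by
  have h2 : binExp p q n (logRatio p n)
      ≤ binExp p q n (fun k => ((k : ℝ) + 1) / (p * ((n : ℝ) + 1)) - 1) :=
    binExp_mono hp.le hq.le fun k _ => Real.log_le_sub_one_of_pos (by positivity)
  rw [binExp_sub, binExp_const hpq, binExp_ratio hp hpq] at h2
  linarith

lemma binExp_sq_logRatio_le (hp : 0 < p) (hq : 0 < q) (hpq : p + q = 1) (n : ℕ) :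
    binExp p q n (fun k => logRatio p n k ^ 2) ≤ 4 * (q / (p * ((n : ℝ) + 1))) := by
  have h1 := binExp_inv_ratio_le hp hq hpq n
  have h2 : binExp p q n (fun k => logRatio p n k ^ 2)
      ≤ binExp p q n (fun k => 4 * (((k : ℝ) + 1) / (p * ((n : ℝ) + 1)) - 2
          + (((k : ℝ) + 1) / (p * ((n : ℝ) + 1)))⁻¹)) :=
    binExp_mono hp.le hq.le fun k _ => sq_log_le (by positivity)
  rw [binExp_mul, binExp_add, binExp_sub, binExp_const hpq, binExp_ratio hp hpq] at h2
  linarith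

lemma binExp_log_add_one (hp : 0 < p) (hpq : p + q = 1) (n : ℕ) :
    binExp p q n (fun k => Real.log ((k : ℝ) + 1))
      = binExp p q n (logRatio p n) + (Real.log p + Real.log ((n : ℝ) + 1)) := by
  rw [← binExp_const hpq n (Real.log p + Real.log ((n : ℝ) + 1)), ← binExp_add]
  exact binExp_congr fun k _ => by rw [logRatio_eq hp]; ring

/-- `n ↦ log (n + 1)` almost solves the recursion for the differences of the mean path length. -/
lemma abs_entropy_defect_le (hp : 0 < p) (hq : 0 < q) (hpq : p + q = 1) (n : ℕ) :
    |binExp p q n (fun k => p * Real.log ((k : ℝ) + 1) + q * Real.log (((n - k : ℕ) : ℝ) + 1))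
      + (-(p * Real.log p) - q * Real.log q) - Real.log ((n : ℝ) + 1)| ≤ 1 / ((n : ℝ) + 1) := by
  rw [binExp_add, binExp_mul, binExp_mul, binExp_reflect n (fun k => Real.log ((k : ℝ) + 1)),
    binExp_log_add_one hp hpq, binExp_log_add_one hq (by linarith)]
  have h1 := binExp_logRatio_nonneg hp hq hpq n
  have h2 := binExp_logRatio_le hp hq hpq n
  have h3 := binExp_logRatio_nonneg hq hp (by linarith) n
  have h4 := binExp_logRatio_le hq hp (by linarith) n
  set A := binExp p q n (logRatio p n)
  set B := binExp q p n (logRatio q n)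
  have h5 : p * (A + (Real.log p + Real.log ((n : ℝ) + 1)))
      + q * (B + (Real.log q + Real.log ((n : ℝ) + 1)))
      + (-(p * Real.log p) - q * Real.log q) - Real.log ((n : ℝ) + 1) = p * A + q * B := by
    linear_combination Real.log ((n : ℝ) + 1) * hpq
  rw [h5, abs_of_nonneg (by positivity)]
  calc p * A + q * B ≤ p * (q / (p * ((n : ℝ) + 1))) + q * (p / (q * ((n : ℝ) + 1))) := by gcongr
    _ = (p + q) / ((n : ℝ) + 1) := by field_simp; ring
    _ = _ := by rw [hpq]

end LogMoments

section MeanPathLength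

variable {p q : ℝ}

lemma binVar_neg (n : ℕ) (f : ℕ → ℝ) : binVar p q n (fun k => -f k) = binVar p q n f := by
  have h1 : binExp p q n (fun k => -f k) = -binExp p q n f := by
    have := binExp_mul (p := p) (q := q) n (-1) f
    simpa only [neg_one_mul] using this
  unfold binVar
  rw [h1]
  exact binExp_congr fun k _ => by ring

lemma splitExp_succ_sub (n : ℕ) (x : ℕ → ℝ) (hpq : p + q = 1) :
    splitExp p q x (n + 1) - splitExp p q x n
      = binExp p q n (fun k => p * (x (k + 1) - x k) + q * (x (n - k + 1) - x (n - k))) := by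
  rw [splitExp, splitExp, binExp_succ, ← binExp_sub]
  refine binExp_congr fun k hk => ?_
  have h1 : n + 1 - k = n - k + 1 := by omega
  have hq : q = 1 - p := by linarith
  rw [Nat.add_sub_add_right, h1, hq]
  ring

/-- The increment of the mean path length, centred by its logarithmic main term. -/
noncomputable def centredDiff (h : ℝ) (a : ℕ → ℝ) (n : ℕ) : ℝ :=
  a (n + 1) - a n - Real.log ((n : ℝ) + 1) / h

lemma abs_centredDiff_defect_le (hp : 0 < p) (hq : 0 < q) (hpq : p + q = 1) {h : ℝ} (hpos : 0 < h)
    (hh : h = -(p * Real.log p) - q * Real.log q) {a : ℕ → ℝ} (a0 : a 0 = 0) (a1 : a 1 = 0)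
    (ha : ∀ n : ℕ, 2 ≤ n → a n = n + splitExp p q a n) {n : ℕ} (hn : 1 ≤ n) :
    |centredDiff h a n
      - binExp p q n (fun k => p * centredDiff h a k + q * centredDiff h a (n - k))|
      ≤ (h⁻¹ + 2) / ((n : ℝ) + 1) := by
  have hL1 : splitExp p q a 1 = 0 := by
    simp [splitExp, binExp, Finset.sum_range_succ, a0, a1]
  have hdiff := splitExp_succ_sub (p := p) (q := q) n a hpq
  have hlog := abs_entropy_defect_le hp hq hpq n
  rw [← hh] at hlog
  set E := binExp p q n
    (fun k => p * Real.log ((k : ℝ) + 1) + q * Real.log (((n - k : ℕ) : ℝ) + 1)) with hE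
  have hsplit : binExp p q n (fun k => p * centredDiff h a k + q * centredDiff h a (n - k))
      = binExp p q n (fun k => p * (a (k + 1) - a k) + q * (a (n - k + 1) - a (n - k)))
        - h⁻¹ * E := by
    rw [hE, ← binExp_mul, ← binExp_sub]
    exact binExp_congr fun k _ => by unfold centredDiff; ring
  rw [hsplit, ← hdiff]
  have hτ : ∃ s : ℝ, 0 ≤ s ∧ s ≤ 2 / ((n : ℝ) + 1) ∧
      a (n + 1) - a n = 1 + s + (splitExp p q a (n + 1) - splitExp p q a n) := by
    rcases hn.eq_or_lt with rfl | hn2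
    · refine ⟨1, zero_le_one, by norm_num, ?_⟩
      have := ha 2 le_rfl
      norm_num at this ⊢
      rw [this, a1, hL1]
      ring
    · refine ⟨0, le_rfl, by positivity, ?_⟩
      have h1 := ha n hn2
      have h2 := ha (n + 1) (by omega)
      push_cast at h2
      linarith
  obtain ⟨s, hs0, hs1, hs⟩ := hτ
  have hid : centredDiff h a n - (splitExp p q a (n + 1) - splitExp p q a n - h⁻¹ * E)
      = s + h⁻¹ * (E + h - Real.log ((n : ℝ) + 1)) := by
    unfold centredDiff
    rw [hs]
    field_simp
    ring
  rw [hid]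
  calc _ ≤ |s| + |h⁻¹ * (E + h - Real.log ((n : ℝ) + 1))| := abs_add_le _ _
    _ ≤ 2 / ((n : ℝ) + 1) + h⁻¹ * (1 / ((n : ℝ) + 1)) := by
        rw [abs_of_nonneg hs0, abs_mul, abs_of_pos (inv_pos.mpr hpos)]
        gcongr
    _ = _ := by ring

/-- The centred increments of the mean path length are bounded. -/
lemma exists_abs_centredDiff_le (hp : 0 < p) (hq : 0 < q) (hpq : p + q = 1) {h : ℝ} (hpos : 0 < h)
    (hh : h = -(p * Real.log p) - q * Real.log q) {a : ℕ → ℝ} (a0 : a 0 = 0) (a1 : a 1 = 0)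
    (ha : ∀ n : ℕ, 2 ≤ n → a n = n + splitExp p q a n) :
    ∃ M, 0 ≤ M ∧ ∀ n, |centredDiff h a n| ≤ M := by
  have hpq0 : 0 < p * q := mul_pos hp hq
  set D := h⁻¹ + 2 with hD
  have hDpos : 0 < D := by positivity
  set M := D / (2 * p * q) with hM
  have hMD : M * (2 * p * q) = D := by rw [hM]; field_simp
  have hε0 : centredDiff h a 0 = 0 := by simp [centredDiff, a0, a1]
  have hy : ∀ n, 2 ≤ n → splitExp p q (fun k => M * ((k - 1 : ℕ) : ℝ)) n + D
      ≤ M * ((n - 1 : ℕ) : ℝ) := by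
    intro n hn
    have h1 := splitExp_linear (p := p) (q := q) n (fun k => ((k - 1 : ℕ) : ℝ)) 0 M 0
    simp only [zero_mul, add_zero] at h1
    have h2 := splitExp_pred_le hp hq hpq hn
    have hM0 : 0 ≤ M := by positivity
    rw [h1]
    nlinarith
  have hstep : ∀ s : ℝ, |s| = 1 → ∀ n : ℕ, 2 ≤ n →
      (n : ℝ) * (s * centredDiff h a (n - 1))
        ≤ splitExp p q (fun k => (k : ℝ) * (s * centredDiff h a (k - 1))) n + D := by
    intro s hs n hn
    obtain ⟨m, rfl⟩ : ∃ m, n = m + 1 := ⟨n - 1, by omega⟩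
    rw [splitExp_succ_mul m (fun k => s * centredDiff h a k)]
    have h1 := abs_centredDiff_defect_le hp hq hpq hpos hh a0 a1 ha (n := m) (by omega)
    have h2 : binExp p q m (fun k => p * (s * centredDiff h a k) + q * (s * centredDiff h a (m - k)))
        = s * binExp p q m (fun k => p * centredDiff h a k + q * centredDiff h a (m - k)) := by
      rw [← binExp_mul]
      exact binExp_congr fun k _ => by ring
    rw [h2, Nat.add_sub_cancel]
    set x := centredDiff h a m
    set E := binExp p q m (fun k => p * centredDiff h a k + q * centredDiff h a (m - k))
    have h3 : s * (x - E) ≤ D / ((m : ℝ) + 1) := by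
      calc s * (x - E) ≤ |s * (x - E)| := le_abs_self _
        _ = |x - E| := by rw [abs_mul, hs, one_mul]
        _ ≤ _ := h1
    rw [le_div_iff₀ (by positivity)] at h3
    push_cast
    linarith
  have hcmp : ∀ s : ℝ, |s| = 1 → ∀ n : ℕ, s * centredDiff h a n ≤ M := by
    intro s hs n
    have h1 := le_of_splitExp hp hq hpq (x := fun k => (k : ℝ) * (s * centredDiff h a (k - 1)))
      (y := fun k => M * ((k - 1 : ℕ) : ℝ)) (t := fun _ => D) (by simp) (by simp [hε0])
      (hstep s hs) hy (n + 1)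
    simp only [Nat.add_sub_cancel] at h1
    push_cast at h1
    have hM0 : 0 ≤ M := by positivity
    have hn0 : (0 : ℝ) < (n : ℝ) + 1 := by positivity
    by_contra hlt
    push Not at hlt
    nlinarith
  refine ⟨M, by positivity, fun n => abs_le.mpr ⟨?_, ?_⟩⟩
  · have := hcmp (-1) (by simp) n
    linarith
  · have := hcmp 1 (by simp) n
    linarith

lemma exists_abs_sub_log_factorial_le (hp : 0 < p) (hq : 0 < q) (hpq : p + q = 1) {h : ℝ}
    (hpos : 0 < h) (hh : h = -(p * Real.log p) - q * Real.log q) {a : ℕ → ℝ} (a0 : a 0 = 0)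
    (a1 : a 1 = 0) (ha : ∀ n : ℕ, 2 ≤ n → a n = n + splitExp p q a n) :
    ∃ M, 0 ≤ M ∧ ∀ n : ℕ, |a n - Real.log (n.factorial) / h| ≤ M * n := by
  obtain ⟨M, hM0, hM⟩ := exists_abs_centredDiff_le hp hq hpq hpos hh a0 a1 ha
  refine ⟨M, hM0, fun n => ?_⟩
  induction n with
  | zero => simp [a0]
  | succ n ih =>
    have h1 : a (n + 1) - Real.log ((n + 1).factorial) / h
        = (a n - Real.log (n.factorial) / h) + centredDiff h a n := by
      rw [Nat.factorial_succ, centredDiff]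
      push_cast
      rw [Real.log_mul (by positivity) (by exact_mod_cast n.factorial_ne_zero)]
      ring
    rw [h1]
    calc _ ≤ |a n - Real.log (n.factorial) / h| + |centredDiff h a n| := abs_add_le _ _
      _ ≤ M * n + M := add_le_add ih (hM n)
      _ = _ := by push_cast; ring

lemma abs_sub_mul_log_div_le {h M : ℝ} (hpos : 0 < h) {x : ℝ} {n : ℕ} (hn : 1 ≤ n)
    (hx : |x - Real.log (n.factorial) / h| ≤ M * n) :
    |x - n * Real.log n / h| ≤ (M + h⁻¹) * n := by
  have hn1 : (1 : ℝ) ≤ n := by exact_mod_cast hn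
  have h1 : (n : ℝ) * Real.log n - n ≤ Real.log (n.factorial) := by
    have := Stirling.le_log_factorial_stirling (n := n) (by omega)
    have h2 : 0 ≤ Real.log n := Real.log_nonneg hn1
    have h3 : 0 ≤ Real.log (2 * Real.pi) := Real.log_nonneg (by linarith [Real.pi_gt_three])
    linarith
  have h2 : Real.log (n.factorial) ≤ n * Real.log n := by
    rw [← Real.log_pow]
    exact Real.log_le_log (by exact_mod_cast n.factorial_pos) (by exact_mod_cast n.factorial_le_pow)
  have h3 : |Real.log (n.factorial) / h - n * Real.log n / h| ≤ h⁻¹ * n := by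
    rw [← sub_div, abs_div, abs_of_pos hpos, div_eq_inv_mul]
    gcongr
    rw [abs_le]
    constructor <;> linarith
  calc _ = |(x - Real.log (n.factorial) / h)
        + (Real.log (n.factorial) / h - n * Real.log n / h)| := by ring_nf
    _ ≤ _ := abs_add_le _ _
    _ ≤ M * n + h⁻¹ * n := add_le_add hx h3
    _ = _ := by ring

/-- The energy estimate for the centred increments. -/
lemma exists_energy_le (hp : 0 < p) (hq : 0 < q) (hpq : p + q = 1) {h : ℝ}
    (hpos : 0 < h) (hh : h = -(p * Real.log p) - q * Real.log q) {a : ℕ → ℝ} (a0 : a 0 = 0)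
    (a1 : a 1 = 0) (ha : ∀ n : ℕ, 2 ≤ n → a n = n + splitExp p q a n) :
    ∃ C, 0 ≤ C ∧ ∀ m : ℕ, 1 ≤ m →
      ((m : ℝ) + 1) * (p * q * binExp p q m
          (fun k => (centredDiff h a k - centredDiff h a (m - k)) ^ 2))
        ≤ splitExp p q (fun k => (k : ℝ) * centredDiff h a (k - 1) ^ 2) (m + 1)
          - ((m : ℝ) + 1) * centredDiff h a m ^ 2 + C := by
  obtain ⟨M, hM0, hM⟩ := exists_abs_centredDiff_le hp hq hpq hpos hh a0 a1 ha
  refine ⟨2 * M * (h⁻¹ + 2), by positivity, fun m hm => ?_⟩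
  have h1 := abs_centredDiff_defect_le hp hq hpq hpos hh a0 a1 ha hm
  have hMm := hM m
  rw [splitExp_succ_mul m (fun k => centredDiff h a k ^ 2)]
  have h2 := sq_binExp_le hp.le hq.le hpq m
    (fun k => p * centredDiff h a k + q * centredDiff h a (m - k))
  have h3 : binExp p q m (fun k => p * centredDiff h a k ^ 2 + q * centredDiff h a (m - k) ^ 2)
      = binExp p q m (fun k => (p * centredDiff h a k + q * centredDiff h a (m - k)) ^ 2)
        + p * q * binExp p q m
          (fun k => (centredDiff h a k - centredDiff h a (m - k)) ^ 2) := by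
    rw [← binExp_mul, ← binExp_add]
    have hq' : q = 1 - p := by linarith
    exact binExp_congr fun k _ => by rw [hq']; ring
  rw [h3]
  set x := centredDiff h a m
  set E := binExp p q m (fun k => p * centredDiff h a k + q * centredDiff h a (m - k))
  set D := h⁻¹ + 2
  have h4 : x ^ 2 - E ^ 2 ≤ 2 * M * (D / ((m : ℝ) + 1)) := by
    have h5 : x * (x - E) ≤ M * (D / ((m : ℝ) + 1)) := by
      calc x * (x - E) ≤ |x * (x - E)| := le_abs_self _
        _ = |x| * |x - E| := abs_mul _ _
        _ ≤ _ := by gcongr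
    nlinarith [sq_nonneg (x - E)]
  have h6 : ((m : ℝ) + 1) * (x ^ 2 - E ^ 2) ≤ 2 * M * D := by
    calc _ ≤ ((m : ℝ) + 1) * (2 * M * (D / ((m : ℝ) + 1))) := by gcongr
      _ = _ := by field_simp
  have h7 : ((m : ℝ) + 1) * E ^ 2 ≤ ((m : ℝ) + 1) * binExp p q m
      (fun k => (p * centredDiff h a k + q * centredDiff h a (m - k)) ^ 2) := by gcongr
  linarith

/-- The non-linear part of the toll of the variance recursion contributes only linearly. -/
lemma exists_supersolution (hp : 0 < p) (hq : 0 < q) (hpq : p + q = 1) {h : ℝ}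
    (hpos : 0 < h) (hh : h = -(p * Real.log p) - q * Real.log q) {a : ℕ → ℝ} (a0 : a 0 = 0)
    (a1 : a 1 = 0) (ha : ∀ n : ℕ, 2 ≤ n → a n = n + splitExp p q a n) :
    ∃ (γ : ℕ → ℝ) (C : ℝ), 0 ≤ C ∧ γ 0 = 0 ∧ γ 1 = 0 ∧ (∀ n : ℕ, γ n ≤ C * n) ∧
      ∀ n : ℕ, 2 ≤ n → splitExp p q γ n
        + binVar p q n (fun k => a k + a (n - k) - Real.log (p / q) / h * k) ≤ γ n := by
  obtain ⟨C, hC0, hC⟩ := exists_energy_le hp hq hpq hpos hh a0 a1 ha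
  have hpq0 : 0 < p * q := mul_pos hp hq
  have hε0 : centredDiff h a 0 = 0 := by simp [centredDiff, a0, a1]
  set K := 2 * C + 16 / h ^ 2 with hK
  have hK0 : 0 ≤ K := by positivity
  set u : ℕ → ℝ := fun k => (k : ℝ) * centredDiff h a (k - 1) ^ 2 with hu
  refine ⟨fun k => K / (2 * p * q) * ((k - 1 : ℕ) : ℝ) + (-2) * u k, K / (2 * p * q),
    by positivity, by simp [hu], by simp [hu, hε0], fun n => ?_, fun n hn => ?_⟩
  · have h1 : 0 ≤ u n := by simp only [hu]; positivity
    have h2 : ((n - 1 : ℕ) : ℝ) ≤ n := by exact_mod_cast Nat.sub_le n 1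
    have h3 : K / (2 * p * q) * ((n - 1 : ℕ) : ℝ) ≤ K / (2 * p * q) * n := by gcongr
    linarith
  · rw [splitExp_linear]
    have h1 := splitExp_pred_le hp hq hpq hn
    have h2 : K / (2 * p * q) * splitExp p q (fun k => ((k - 1 : ℕ) : ℝ)) n
        ≤ K / (2 * p * q) * ((n - 1 : ℕ) : ℝ) - K := by
      calc _ ≤ K / (2 * p * q) * (((n - 1 : ℕ) : ℝ) - 2 * p * q) := by gcongr
        _ = _ := by field_simp
    suffices h3 : binVar p q n (fun k => a k + a (n - k) - Real.log (p / q) / h * k)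
        ≤ 2 * (splitExp p q u n - u n) + K by linarith
    obtain ⟨m, rfl⟩ : ∃ m, n = m + 1 := ⟨n - 1, by omega⟩
    have hE := hC m (by omega)
    have hum : u (m + 1) = ((m : ℝ) + 1) * centredDiff h a m ^ 2 := by simp [hu]
    have hES := binVar_succ_le hp.le hq.le hpq m
      (fun k => a k + a (m + 1 - k) - Real.log (p / q) / h * k)
    have hinc : binExp p q m (fun k => (a (k + 1) + a (m + 1 - (k + 1))
          - Real.log (p / q) / h * ((k + 1 : ℕ) : ℝ)
          - (a k + a (m + 1 - k) - Real.log (p / q) / h * k)) ^ 2)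
        ≤ binExp p q m (fun k => 2 * (centredDiff h a k - centredDiff h a (m - k)) ^ 2
          + 4 / h ^ 2 * (logRatio p m k ^ 2 + logRatio q m (m - k) ^ 2)) := by
      refine binExp_mono hp.le hq.le fun k hk => ?_
      have hs : m + 1 - k = m - k + 1 := by omega
      have hid : a (k + 1) + a (m + 1 - (k + 1)) - Real.log (p / q) / h * ((k + 1 : ℕ) : ℝ)
          - (a k + a (m + 1 - k) - Real.log (p / q) / h * k)
          = (centredDiff h a k - centredDiff h a (m - k))
            + (logRatio p m k - logRatio q m (m - k)) / h := by
        rw [Nat.add_sub_add_right, hs, logRatio_eq hp, logRatio_eq hq,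
          Real.log_div hp.ne' hq.ne', centredDiff, centredDiff]
        push_cast
        ring
      rw [hid]
      set x := centredDiff h a k - centredDiff h a (m - k)
      set y := logRatio p m k
      set z := logRatio q m (m - k)
      have h5 : 2 * x ^ 2 + 4 / h ^ 2 * (y ^ 2 + z ^ 2) - (x + (y - z) / h) ^ 2
          = (x - (y - z) / h) ^ 2 + 2 * ((y + z) / h) ^ 2 := by
        field_simp; ring
      have h6 : 0 ≤ (x - (y - z) / h) ^ 2 + 2 * ((y + z) / h) ^ 2 := by positivity
      linarith
    rw [binExp_add, binExp_mul, binExp_mul, binExp_add,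
      binExp_reflect m (fun k => logRatio q m k ^ 2)] at hinc
    have hl1 := binExp_sq_logRatio_le hp hq hpq m
    have hl2 := binExp_sq_logRatio_le hq hp (by linarith) m
    set A := binExp p q m (fun k => (centredDiff h a k - centredDiff h a (m - k)) ^ 2)
    have hfin : ((m : ℝ) + 1) * (p * q * (4 / h ^ 2 * (4 * (q / (p * ((m : ℝ) + 1)))
        + 4 * (p / (q * ((m : ℝ) + 1)))))) ≤ 16 / h ^ 2 := by
      have h7 : ((m : ℝ) + 1) * (p * q * (4 / h ^ 2 * (4 * (q / (p * ((m : ℝ) + 1)))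
        + 4 * (p / (q * ((m : ℝ) + 1)))))) = 16 / h ^ 2 * (p ^ 2 + q ^ 2) := by
        field_simp; ring
      rw [h7]
      have h8 : p ^ 2 + q ^ 2 ≤ 1 := by nlinarith
      have h9 : 0 ≤ 16 / h ^ 2 := by positivity
      nlinarith
    calc _ ≤ _ := hES
      _ ≤ ((m : ℝ) + 1) * (p * q * (2 * A + 4 / h ^ 2 * (4 * (q / (p * ((m : ℝ) + 1)))
        + 4 * (p / (q * ((m : ℝ) + 1)))))) := by
          gcongr
          refine hinc.trans ?_
          gcongr
      _ = 2 * (((m : ℝ) + 1) * (p * q * A)) + ((m : ℝ) + 1) * (p * q * (4 / h ^ 2 *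
        (4 * (q / (p * ((m : ℝ) + 1))) + 4 * (p / (q * ((m : ℝ) + 1)))))) := by ring
      _ ≤ _ := by rw [hum, hK]; linarith

end MeanPathLength

section VarianceAsymptotics

variable {p q : ℝ}

lemma tendsto_div_mul_log_of_bounds {κ h C M : ℝ} (hκ : 0 ≤ κ) {a v : ℕ → ℝ}
    (ha : ∀ n : ℕ, 1 ≤ n → |a n - n * Real.log n / h| ≤ M * n)
    (hup : ∀ θ : ℝ, 0 < θ → ∀ n : ℕ, v n ≤ (1 + θ) * (κ * a n) + (1 + θ⁻¹) * (C * n))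
    (hlo : ∀ θ : ℝ, 0 < θ → ∀ n : ℕ, κ * a n ≤ (1 + θ) * v n + (1 + θ⁻¹) * (C * n)) :
    Tendsto (fun n : ℕ => v n / ((n : ℝ) * Real.log n)) atTop (𝓝 (κ / h)) := by
  have hlog : Tendsto (fun n : ℕ => Real.log (n : ℝ)) atTop atTop :=
    Real.tendsto_log_atTop.comp tendsto_natCast_atTop_atTop
  have hs : Tendsto (fun n : ℕ => (√(Real.log (n : ℝ)))⁻¹) atTop (𝓝 0) :=
    (Real.tendsto_sqrt_atTop.comp hlog).inv_tendsto_atTop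
  have hup' : Tendsto (fun n : ℕ => (1 + (√(Real.log (n : ℝ)))⁻¹)
      * (κ / h + κ * M * (√(Real.log (n : ℝ)))⁻¹ ^ 2)
      + C * ((√(Real.log (n : ℝ)))⁻¹ ^ 2 + (√(Real.log (n : ℝ)))⁻¹)) atTop (𝓝 (κ / h)) := by
    have := ((hs.const_add 1).mul (((hs.pow 2).const_mul (κ * M)).const_add (κ / h))).add
      (((hs.pow 2).add hs).const_mul C)
    simpa using this
  have hlo' : Tendsto (fun n : ℕ => (1 + (√(Real.log (n : ℝ)))⁻¹)⁻¹
      * (κ / h - κ * M * (√(Real.log (n : ℝ)))⁻¹ ^ 2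
      - C * ((√(Real.log (n : ℝ)))⁻¹ ^ 2 + (√(Real.log (n : ℝ)))⁻¹))) atTop (𝓝 (κ / h)) := by
    have := ((hs.const_add 1).inv₀ (by simp)).mul
      ((((hs.pow 2).const_mul (κ * M)).const_sub (κ / h)).sub
      (((hs.pow 2).add hs).const_mul C))
    simpa using this
  refine tendsto_of_tendsto_of_tendsto_of_le_of_le' hlo' hup' ?_ ?_
  · filter_upwards [hlog.eventually_gt_atTop 0, eventually_ge_atTop 1] with n hL hn
    have hn0 : (0 : ℝ) < n := by exact_mod_cast hn
    set L := Real.log (n : ℝ) with hLdef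
    obtain ⟨s, hs0, hsL⟩ : ∃ s, 0 < s ∧ L = s ^ 2 :=
      ⟨√L, Real.sqrt_pos.mpr hL, (Real.sq_sqrt hL.le).symm⟩
    have h1 := hlo s⁻¹ (by positivity) n
    have h2 := (abs_le.mp (ha n hn)).1
    have h3 : κ * (n * L / h - M * n) ≤ κ * a n := by
      refine mul_le_mul_of_nonneg_left ?_ hκ
      linarith
    rw [hsL, Real.sqrt_sq hs0.le, inv_mul_le_iff₀ (by positivity), ← mul_div_assoc,
      le_div_iff₀ (by positivity)]
    rw [inv_inv] at h1
    rw [hsL] at h3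
    have h4 : (κ / h - κ * M * s⁻¹ ^ 2 - C * (s⁻¹ ^ 2 + s⁻¹)) * (n * s ^ 2)
        = κ * (n * s ^ 2 / h - M * n) - (1 + s) * (C * n) := by
      have h5 : s⁻¹ ^ 2 * s ^ 2 = 1 := by field_simp
      have h6 : s⁻¹ * s ^ 2 = s := by field_simp
      linear_combination (- κ * M * n - C * n) * h5 - C * n * h6
    rw [h4]
    linarith
  · filter_upwards [hlog.eventually_gt_atTop 0, eventually_ge_atTop 1] with n hL hn
    have hn0 : (0 : ℝ) < n := by exact_mod_cast hn
    set L := Real.log (n : ℝ) with hLdef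
    obtain ⟨s, hs0, hsL⟩ : ∃ s, 0 < s ∧ L = s ^ 2 :=
      ⟨√L, Real.sqrt_pos.mpr hL, (Real.sq_sqrt hL.le).symm⟩
    have h1 := hup s⁻¹ (by positivity) n
    have h2 := (abs_le.mp (ha n hn)).2
    have h3 : κ * a n ≤ κ * (n * L / h + M * n) := by
      refine mul_le_mul_of_nonneg_left ?_ hκ
      linarith
    rw [hsL, Real.sqrt_sq hs0.le, div_le_iff₀ (by positivity)]
    rw [inv_inv] at h1
    rw [hsL] at h3
    have h3' : (1 + s⁻¹) * (κ * a n) ≤ (1 + s⁻¹) * (κ * (n * s ^ 2 / h + M * n)) := by gcongr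
    have h4 : ((1 + s⁻¹) * (κ / h + κ * M * s⁻¹ ^ 2) + C * (s⁻¹ ^ 2 + s⁻¹)) * (n * s ^ 2)
        = (1 + s⁻¹) * (κ * (n * s ^ 2 / h + M * n)) + (1 + s) * (C * n) := by
      have h5 : s⁻¹ ^ 2 * s ^ 2 = 1 := by field_simp
      have h6 : s⁻¹ * s ^ 2 = s := by field_simp
      linear_combination ((1 + s⁻¹) * κ * M * n + C * n) * h5 + C * n * h6
    rw [h4]
    linarith

/-- The asymptotics of a sequence obeying the recursion for the variance of the path length. -/
theorem tendsto_variance_recursion (hp : 0 < p) (hq : 0 < q) (hpq : p + q = 1) {h : ℝ}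
    (hh : h = -(p * Real.log p) - q * Real.log q) {a v : ℕ → ℝ} (a0 : a 0 = 0)
    (a1 : a 1 = 0) (ha : ∀ n : ℕ, 2 ≤ n → a n = n + splitExp p q a n)
    (v0 : v 0 = 0) (v1 : v 1 = 0)
    (hv : ∀ n : ℕ, 2 ≤ n → v n = splitExp p q v n + binVar p q n (fun k => a k + a (n - k))) :
    Tendsto (fun n : ℕ => v n / ((n : ℝ) * Real.log n)) atTop
      (𝓝 (p * q * Real.log (p / q) ^ 2 / h ^ 3)) := by
  have hpos : 0 < h := by
    have h1 : Real.log p < 0 := Real.log_neg hp (by linarith)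
    have h2 : Real.log q < 0 := Real.log_neg hq (by linarith)
    rw [hh]
    nlinarith
  obtain ⟨M, hM0, hM⟩ := exists_abs_sub_log_factorial_le hp hq hpq hpos hh a0 a1 ha
  obtain ⟨γ, C, hC0, γ0, γ1, hγC, hγ⟩ := exists_supersolution hp hq hpq hpos hh a0 a1 ha
  set c := Real.log (p / q) / h with hc
  have hlim : p * q * Real.log (p / q) ^ 2 / h ^ 3 = p * q * c ^ 2 / h := by
    rw [hc]; field_simp
  rw [hlim]
  have hlin : ∀ n, binVar p q n (fun k => c * k) = p * q * c ^ 2 * n := fun n => by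
    simpa using binVar_affine (p := p) (q := q) hpq n c 0
  refine tendsto_div_mul_log_of_bounds (M := M + h⁻¹) (C := C) (a := a) (by positivity)
    (fun n hn => abs_sub_mul_log_div_le hpos hn (hM n)) (fun θ hθ n => ?_) (fun θ hθ n => ?_)
  · have h1 := le_of_splitExp hp hq hpq (x := v)
      (y := fun k => ((1 + θ) * (p * q * c ^ 2)) * a k + (1 + θ⁻¹) * γ k)
      (t := fun n => binVar p q n (fun k => a k + a (n - k))) (by simp [v0, a0, γ0])
      (by simp [v1, a1, γ1]) (fun n hn => (hv n hn).le) (fun n hn => ?_) n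
    · have h2 : (1 + θ⁻¹) * γ n ≤ (1 + θ⁻¹) * (C * n) := by
        have := hγC n
        gcongr
      linarith
    · rw [splitExp_linear]
      have h2 := binVar_add_le hp.le hq.le n (fun k => c * k)
        (fun k => a k + a (n - k) - c * k) hθ
      rw [hlin] at h2
      simp only [add_sub_cancel] at h2
      have h3 : (1 + θ⁻¹) * (splitExp p q γ n
          + binVar p q n (fun k => a k + a (n - k) - c * k)) ≤ (1 + θ⁻¹) * γ n := by
        have := hγ n hn
        gcongr
      have h4 := ha n hn
      have h5 : (1 + θ) * (p * q * c ^ 2) * a n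
          = (1 + θ) * (p * q * c ^ 2) * splitExp p q a n + (1 + θ) * (p * q * c ^ 2 * n) := by
        linear_combination ((1 + θ) * (p * q * c ^ 2)) * h4
      linarith
  · have h1 := le_of_splitExp hp hq hpq (x := fun k => p * q * c ^ 2 * a k)
      (y := fun k => (1 + θ) * v k + (1 + θ⁻¹) * γ k)
      (t := fun n => p * q * c ^ 2 * n) (by simp [v0, a0, γ0])
      (by simp [v1, a1, γ1]) (fun n hn => ?_) (fun n hn => ?_) n
    · have h2 : (1 + θ⁻¹) * γ n ≤ (1 + θ⁻¹) * (C * n) := by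
        have := hγC n
        gcongr
      linarith
    · have h2 := splitExp_linear (p := p) (q := q) n a 0 (p * q * c ^ 2) 0
      simp only [zero_mul, add_zero] at h2
      rw [h2]
      have h4 := ha n hn
      exact (by linear_combination (p * q * c ^ 2) * h4 : p * q * c ^ 2 * a n = _).le
    · rw [splitExp_linear]
      have h2 := binVar_add_le hp.le hq.le n (fun k => a k + a (n - k))
        (fun k => -(a k + a (n - k) - c * k)) hθ
      rw [binVar_neg] at h2
      have h6 : (fun k : ℕ => a k + a (n - k) + -(a k + a (n - k) - c * k))
          = fun k : ℕ => c * (k : ℝ) := by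
        funext k; ring
      rw [h6, hlin] at h2
      have h3 : (1 + θ⁻¹) * (splitExp p q γ n
          + binVar p q n (fun k => a k + a (n - k) - c * k)) ≤ (1 + θ⁻¹) * γ n := by
        have := hγ n hn
        gcongr
      have h4 : (1 + θ) * v n = (1 + θ) * splitExp p q v n
          + (1 + θ) * binVar p q n (fun k => a k + a (n - k)) := by
        linear_combination (1 + θ) * hv n hn
      linarith

end VarianceAsymptotics

section TrieMoments

variable {p : ℝ} {μ : ℕ → Measure (ℕ × ℕ)}

lemma integral_binomialMeasure (hp0 : 0 ≤ p) (hp1 : p ≤ 1) (n : ℕ) (f : ℕ → ℝ) :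
    ∫ k, f k ∂binomialMeasure n p = binExp p (1 - p) n f := by
  rw [binomialMeasure, integral_finsetSum_measure]
  · refine Finset.sum_congr rfl fun k _ => ?_
    have h1 : 0 ≤ 1 - p := by linarith
    rw [integral_smul_measure, integral_dirac, ENNReal.toReal_ofReal (by positivity), smul_eq_mul]
  · intro k _
    exact (integrable_dirac (by simp)).smul_measure ENNReal.ofReal_ne_top

lemma measurable_trieStep (n : ℕ) : Measurable (trieStep n) := by
  refine measurable_from_prod_countable_right fun k => ?_
  have h1 : Measurable fun y : (ℕ → ℕ × ℕ) × (ℕ → ℕ × ℕ) => y.1 k :=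
    (measurable_pi_apply k).comp measurable_fst
  have h2 : Measurable fun y : (ℕ → ℕ × ℕ) × (ℕ → ℕ × ℕ) => y.2 (n - k) :=
    (measurable_pi_apply (n - k)).comp measurable_snd
  exact ((h1.fst.add h2.fst).add_const 1).prodMk ((h1.snd.add h2.snd).add_const n)

lemma IsTriePairFamily.integrable_snd (hμ : IsTriePairFamily p μ) (n : ℕ) :
    Integrable (fun x : ℕ × ℕ => (x.2 : ℝ)) (μ n) := by
  refine (hμ.moments n 1).mono' (measurable_of_countable _).aestronglyMeasurable
    (ae_of_all _ fun x => ?_)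
  rw [Real.norm_of_nonneg (by positivity)]
  have : (0 : ℝ) ≤ x.1 := by positivity
  linarith

lemma IsTriePairFamily.integrable_snd_sub_sq (hμ : IsTriePairFamily p μ) (n : ℕ) (c : ℝ) :
    Integrable (fun x : ℕ × ℕ => ((x.2 : ℝ) - c) ^ 2) (μ n) := by
  have := hμ.prob n
  have h1 : Integrable (fun x : ℕ × ℕ => (x.2 : ℝ) ^ 2) (μ n) := by
    refine (hμ.moments n 2).mono' (measurable_of_countable _).aestronglyMeasurable
      (ae_of_all _ fun x => ?_)
    rw [Real.norm_of_nonneg (by positivity)]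
    have : (0 : ℝ) ≤ x.1 := by positivity
    gcongr
    linarith
  have h2 : (fun x : ℕ × ℕ => ((x.2 : ℝ) - c) ^ 2)
      = fun x : ℕ × ℕ => (x.2 : ℝ) ^ 2 - 2 * c * x.2 + c ^ 2 := by
    funext x; ring
  rw [h2]
  exact (h1.sub ((hμ.integrable_snd n).const_mul _)).add (integrable_const _)

/-- Conditioning the path length on the size of the left subtree. -/
lemma IsTriePairFamily.exists_integral_eq (hμ : IsTriePairFamily p μ) (hp0 : 0 ≤ p) (hp1 : p ≤ 1)
    {n : ℕ} (hn : 2 ≤ n) :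
    ∃ ν₁ ν₂ : Measure (ℕ → ℕ × ℕ), IsProbabilityMeasure ν₁ ∧ IsProbabilityMeasure ν₂ ∧
      (∀ j, ν₁.map (fun s => s j) = μ j) ∧ (∀ j, ν₂.map (fun s => s j) = μ j) ∧
      ∀ F : ℝ → ℝ, Integrable (fun x : ℕ × ℕ => F x.2) (μ n) →
        ∫ x, F x.2 ∂μ n = binExp p (1 - p) n (fun k =>
          ∫ z, F (((z.1 k).2 : ℝ) + ((z.2 (n - k)).2 : ℝ) + n) ∂ν₁.prod ν₂) := by
  obtain ⟨P, hP, hB, h1, h2, hprod, hstep⟩ := hμ.recur n hn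
  have hm1 : Measurable fun ω : ℕ × ((ℕ → ℕ × ℕ) × (ℕ → ℕ × ℕ)) => ω.2.1 := by fun_prop
  have hm2 : Measurable fun ω : ℕ × ((ℕ → ℕ × ℕ) × (ℕ → ℕ × ℕ)) => ω.2.2 := by fun_prop
  have hpr1 : IsProbabilityMeasure (P.map fun ω => ω.2.1) :=
    Measure.isProbabilityMeasure_map hm1.aemeasurable
  have hpr2 : IsProbabilityMeasure (P.map fun ω => ω.2.2) :=
    Measure.isProbabilityMeasure_map hm2.aemeasurable
  have hprB : IsProbabilityMeasure (P.map Prod.fst) :=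
    Measure.isProbabilityMeasure_map measurable_fst.aemeasurable
  refine ⟨P.map fun ω => ω.2.1, P.map fun ω => ω.2.2, hpr1, hpr2, fun j => ?_, fun j => ?_,
    fun F hF => ?_⟩
  · rw [Measure.map_map (measurable_pi_apply j) hm1, ← h1 j]
    rfl
  · rw [Measure.map_map (measurable_pi_apply j) hm2, ← h2 j]
    rfl
  · have hmeas : Measurable fun x : ℕ × ℕ => F x.2 := measurable_of_countable _
    have hFP : Integrable (fun ω => F ((trieStep n ω).2)) P := by
      rw [hstep] at hF
      exact (integrable_map_measure hmeas.aestronglyMeasurable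
        (measurable_trieStep n).aemeasurable).mp hF
    rw [hstep, integral_map (measurable_trieStep n).aemeasurable hmeas.aestronglyMeasurable,
      ← integral_binomialMeasure hp0 hp1, ← hB]
    set ν₁ := P.map fun ω => ω.2.1
    set ν₂ := P.map fun ω => ω.2.2
    set β := P.map Prod.fst
    rw [hprod] at hFP ⊢
    rw [integral_prod _ hFP]
    simp [trieStep]

lemma IsTriePairFamily.eK_eq_zero (hμ : IsTriePairFamily p μ) {n : ℕ} (hn : n < 2) :
    eK μ n = 0 := by
  interval_cases n
  · simp [eK, hμ.init0]
  · simp [eK, hμ.init1]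

lemma IsTriePairFamily.varK_eq_zero (hμ : IsTriePairFamily p μ) {n : ℕ} (hn : n < 2) :
    varK μ n = 0 := by
  rw [varK, hμ.eK_eq_zero hn]
  interval_cases n
  · simp [hμ.init0]
  · simp [hμ.init1]

lemma IsTriePairFamily.eK_eq (hμ : IsTriePairFamily p μ) (hp0 : 0 ≤ p) (hp1 : p ≤ 1)
    {n : ℕ} (hn : 2 ≤ n) : eK μ n = n + splitExp p (1 - p) (eK μ) n := by
  obtain ⟨ν₁, ν₂, i1, i2, h1, h2, hF⟩ := hμ.exists_integral_eq hp0 hp1 hn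
  have hmeas : ∀ j, Measurable fun s : ℕ → ℕ × ℕ => s j := fun j => measurable_pi_apply j
  have hX : Measurable fun x : ℕ × ℕ => (x.2 : ℝ) := measurable_of_countable _
  have e := hF (fun x => x) (hμ.integrable_snd n)
  have hc : n + splitExp p (1 - p) (eK μ) n
      = binExp p (1 - p) n (fun k => eK μ k + eK μ (n - k) + n) := by
    rw [binExp_add n (fun k => eK μ k + eK μ (n - k)), binExp_const (by ring), splitExp, add_comm]
  rw [eK, e, hc]
  refine binExp_congr fun k _ => ?_
  have j1 : Integrable (fun s : ℕ → ℕ × ℕ => ((s k).2 : ℝ)) ν₁ := by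
    have := hμ.integrable_snd k
    rw [← h1 k] at this
    exact (integrable_map_measure hX.aestronglyMeasurable (hmeas k).aemeasurable).mp this
  have j2 : Integrable (fun s : ℕ → ℕ × ℕ => ((s (n - k)).2 : ℝ)) ν₂ := by
    have := hμ.integrable_snd (n - k)
    rw [← h2 (n - k)] at this
    exact (integrable_map_measure hX.aestronglyMeasurable (hmeas (n - k)).aemeasurable).mp this
  have m1 : ∫ s, ((s k).2 : ℝ) ∂ν₁ = eK μ k := by
    rw [eK, ← h1 k, integral_map (hmeas k).aemeasurable hX.aestronglyMeasurable]
  have m2 : ∫ s, ((s (n - k)).2 : ℝ) ∂ν₂ = eK μ (n - k) := by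
    rw [eK, ← h2 (n - k), integral_map (hmeas (n - k)).aemeasurable hX.aestronglyMeasurable]
  have j12 : Integrable (fun z : (ℕ → ℕ × ℕ) × (ℕ → ℕ × ℕ) =>
      ((z.1 k).2 : ℝ) + ((z.2 (n - k)).2 : ℝ)) (ν₁.prod ν₂) :=
    (j1.comp_fst ν₂).add (j2.comp_snd ν₁)
  rw [integral_add j12 (integrable_const _), integral_add (j1.comp_fst ν₂) (j2.comp_snd ν₁),
    integral_fun_fst (fun s : ℕ → ℕ × ℕ => ((s k).2 : ℝ)),
    integral_fun_snd (fun s : ℕ → ℕ × ℕ => ((s (n - k)).2 : ℝ)), m1, m2]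
  simp

lemma integral_add_add_sq {α β : Type*} [MeasurableSpace α] [MeasurableSpace β] {ν₁ : Measure α}
    {ν₂ : Measure β} [IsProbabilityMeasure ν₁] [IsProbabilityMeasure ν₂] {f : α → ℝ} {g : β → ℝ}
    (hf : Integrable f ν₁) (hg : Integrable g ν₂) (hf2 : Integrable (fun x => f x ^ 2) ν₁)
    (hg2 : Integrable (fun x => g x ^ 2) ν₂) (hf0 : ∫ x, f x ∂ν₁ = 0) (hg0 : ∫ x, g x ∂ν₂ = 0)
    (c : ℝ) :
    ∫ z, (f z.1 + g z.2 + c) ^ 2 ∂ν₁.prod ν₂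
      = ∫ x, f x ^ 2 ∂ν₁ + ∫ x, g x ^ 2 ∂ν₂ + c ^ 2 := by
  have e : (fun z : α × β => (f z.1 + g z.2 + c) ^ 2) = fun z =>
      f z.1 ^ 2 + g z.2 ^ 2 + (2 * (f z.1 * g z.2) + 2 * c * f z.1 + 2 * c * g z.2 + c ^ 2) := by
    funext z; ring
  have i1 := hf2.comp_fst ν₂
  have i2 := hg2.comp_snd ν₁
  have i3 := (hf.mul_prod hg).const_mul 2
  have i4 := (hf.comp_fst ν₂).const_mul (2 * c)
  have i5 := (hg.comp_snd ν₁).const_mul (2 * c)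
  have i6 : Integrable (fun _ : α × β => c ^ 2) (ν₁.prod ν₂) := integrable_const _
  have i12 : Integrable (fun z : α × β => f z.1 ^ 2 + g z.2 ^ 2) (ν₁.prod ν₂) := i1.add i2
  have i34 : Integrable (fun z : α × β => 2 * (f z.1 * g z.2) + 2 * c * f z.1) (ν₁.prod ν₂) :=
    i3.add i4
  have i35 : Integrable (fun z : α × β => 2 * (f z.1 * g z.2) + 2 * c * f z.1 + 2 * c * g z.2)
      (ν₁.prod ν₂) := i34.add i5
  have i36 : Integrable (fun z : α × β =>
      2 * (f z.1 * g z.2) + 2 * c * f z.1 + 2 * c * g z.2 + c ^ 2) (ν₁.prod ν₂) := i35.add i6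
  rw [e, integral_add i12 i36, integral_add i1 i2,
    integral_add i35 i6, integral_add i34 i5, integral_add i3 i4,
    integral_const_mul, integral_const_mul, integral_const_mul, integral_prod_mul,
    integral_fun_fst (fun x => f x ^ 2), integral_fun_snd (fun x => g x ^ 2), integral_fun_fst f,
    integral_fun_snd g, hf0, hg0]
  simp

lemma IsTriePairFamily.varK_eq (hμ : IsTriePairFamily p μ) (hp0 : 0 ≤ p) (hp1 : p ≤ 1)
    {n : ℕ} (hn : 2 ≤ n) :
    varK μ n = splitExp p (1 - p) (varK μ) n
      + binVar p (1 - p) n (fun k => eK μ k + eK μ (n - k)) := by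
  obtain ⟨ν₁, ν₂, i1, i2, h1, h2, hF⟩ := hμ.exists_integral_eq hp0 hp1 hn
  have hmeas : ∀ j, Measurable fun s : ℕ → ℕ × ℕ => s j := fun j => measurable_pi_apply j
  have e := hF (fun x => (x - eK μ n) ^ 2) (hμ.integrable_snd_sub_sq n _)
  rw [varK, e, splitExp, binVar, ← binExp_add]
  refine binExp_congr fun k _ => ?_
  have key : ∀ (ν : Measure (ℕ → ℕ × ℕ)) (j : ℕ), IsProbabilityMeasure ν →
      ν.map (fun s => s j) = μ j →
      Integrable (fun s : ℕ → ℕ × ℕ => ((s j).2 : ℝ) - eK μ j) ν ∧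
      Integrable (fun s : ℕ → ℕ × ℕ => (((s j).2 : ℝ) - eK μ j) ^ 2) ν ∧
      ∫ s, (((s j).2 : ℝ) - eK μ j) ∂ν = 0 ∧
      ∫ s, (((s j).2 : ℝ) - eK μ j) ^ 2 ∂ν = varK μ j := by
    intro ν j hν hj
    have := hμ.prob j
    have hX : Measurable fun x : ℕ × ℕ => (x.2 : ℝ) - eK μ j := measurable_of_countable _
    have hX2 : Measurable fun x : ℕ × ℕ => ((x.2 : ℝ) - eK μ j) ^ 2 := measurable_of_countable _
    have k1 : Integrable (fun x : ℕ × ℕ => (x.2 : ℝ) - eK μ j) (μ j) :=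
      (hμ.integrable_snd j).sub (integrable_const _)
    have k2 := hμ.integrable_snd_sub_sq j (eK μ j)
    have k3 : ∫ x, ((x.2 : ℝ) - eK μ j) ∂μ j = 0 := by
      rw [integral_sub (hμ.integrable_snd j) (integrable_const _)]
      simp [eK]
    have k4 : ∫ x, ((x.2 : ℝ) - eK μ j) ^ 2 ∂μ j = varK μ j := rfl
    rw [← hj] at k1 k2 k3 k4
    rw [integral_map (hmeas j).aemeasurable hX.aestronglyMeasurable] at k3
    rw [integral_map (hmeas j).aemeasurable hX2.aestronglyMeasurable] at k4
    exact ⟨(integrable_map_measure hX.aestronglyMeasurable (hmeas j).aemeasurable).mp k1,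
      (integrable_map_measure hX2.aestronglyMeasurable (hmeas j).aemeasurable).mp k2, k3, k4⟩
  obtain ⟨a1, a2, a3, a4⟩ := key ν₁ k i1 (h1 k)
  obtain ⟨b1, b2, b3, b4⟩ := key ν₂ (n - k) i2 (h2 (n - k))
  have hsum := integral_add_add_sq a1 b1 a2 b2 a3 b3 (eK μ k + eK μ (n - k) + n - eK μ n)
  rw [a4, b4] at hsum
  have hmean := hμ.eK_eq hp0 hp1 hn
  have hc : eK μ k + eK μ (n - k) + n - eK μ n
      = eK μ k + eK μ (n - k) - binExp p (1 - p) n (fun k => eK μ k + eK μ (n - k)) := by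
    rw [hmean, splitExp]
    ring
  rw [← hc, ← hsum]
  congr 1
  funext z
  ring

end TrieMoments

/-- for `p ≠ 1/2`, `Var(K_n)/(n log n) → λ`. -/
theorem stmt19 (p : ℝ) (hp0 : 0 < p) (hp1 : p < 1) (hp : p ≠ 1 / 2) (q : ℝ) (hq : q = 1 - p)
    (h : ℝ) (hh : h = -(p * Real.log p) - q * Real.log q)
    (lam : ℝ) (hlam : lam = p * q * (Real.log (p / q)) ^ 2 / h ^ 3)
    (μ : ℕ → Measure (ℕ × ℕ)) (hμ : IsTriePairFamily p μ) :
    Tendsto (fun n : ℕ => varK μ n / ((n : ℝ) * Real.log n)) atTop (𝓝 lam) := by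
  subst hq
  rw [hlam]
  exact tendsto_variance_recursion hp0 (sub_pos.mpr hp1) (by ring) hh
    (hμ.eK_eq_zero (by norm_num)) (hμ.eK_eq_zero (by norm_num))
    (fun n hn => hμ.eK_eq hp0.le hp1.le hn)
    (hμ.varK_eq_zero (by norm_num)) (hμ.varK_eq_zero (by norm_num))
    (fun n hn => hμ.varK_eq hp0.le hp1.le hn)
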